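/- Let w ∈ Ŵ be minuscule and let γ ∈ Δ⁺ \ I_w. Then I_w ∪ {γ} is an abelian ideal if and only if w(δ − γ) ∈ Π̂. -/

import Mathlib

open scoped BigOperators

/-- Data of a reduced irreducible crystallographic root system `Δ`, spanning a
`ℚ`-vector space `V` equipped with a Weyl-group-invariant inner product `B`,
together with a chosen system of positive roots `Pos` and the highest root `θ`. -/
structure RootSystemCtx (V : Type*) [AddCommGroup V] [Module ℚ V] where
  /-- the invariant inner product `( , )` -/
  B : V →ₗ[ℚ] V →ₗ[ℚ] ℚ
  B_symm : ∀ x y : V, B x y = B y x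
  B_posdef : ∀ x : V, x ≠ 0 → 0 < B x x
  /-- the set of roots -/
  Δ : Set V
  Δ_finite : Δ.Finite
  Δ_spans : Submodule.span ℚ Δ = ⊤
  zero_notMem_Δ : (0 : V) ∉ Δ
  neg_mem_Δ : ∀ α ∈ Δ, -α ∈ Δ
  reduced : ∀ α ∈ Δ, ∀ c : ℚ, c • α ∈ Δ → c = 1 ∨ c = -1
  crystallographic : ∀ α ∈ Δ, ∀ β ∈ Δ, ∃ n : ℤ, 2 * B α β / B β β = (n : ℚ)
  reflect_mem : ∀ α ∈ Δ, ∀ β ∈ Δ, β - (2 * B β α / B α α) • α ∈ Δ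
  irreducible : ∀ S : Set V, S ⊆ Δ → (∀ α ∈ S, ∀ β ∈ Δ \ S, B α β = 0) → S = ∅ ∨ S = Δ
  /-- the positive roots `Δ⁺` -/
  Pos : Set V
  pos_subset : Pos ⊆ Δ
  mem_pos_or_neg_pos : ∀ α ∈ Δ, α ∈ Pos ∨ -α ∈ Pos
  pos_not_neg : ∀ α ∈ Pos, -α ∉ Pos
  add_pos_mem : ∀ α ∈ Pos, ∀ β ∈ Pos, α + β ∈ Δ → α + β ∈ Pos
  /-- the highest root `θ` -/
  θ : V
  θ_pos : θ ∈ Pos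
  θ_highest : ∀ ν ∈ Δ, θ - ν ∈ AddSubmonoid.closure Pos

namespace RootSystemCtx

variable {V : Type*} [AddCommGroup V] [Module ℚ V] (ctx : RootSystemCtx V)

/-- the simple roots `Π`: indecomposable positive roots -/
def simple : Set V :=
  {α | α ∈ ctx.Pos ∧ ¬∃ β ∈ ctx.Pos, ∃ γ ∈ ctx.Pos, α = β + γ}

/-- `ρ`, the half-sum of all positive roots -/
noncomputable def ρ : V :=
  (1 / 2 : ℚ) • ∑ α ∈ (ctx.Δ_finite.subset ctx.pos_subset).toFinset, α

/-- the coroot `μ∨ = 2μ/(μ,μ)` -/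
noncomputable def coroot (μ : V) : V := (2 / ctx.B μ μ) • μ

/-- `Δ⁺_l`, the long positive roots (roots of the same length as `θ`) -/
def PosLong : Set V := {μ | μ ∈ ctx.Pos ∧ ctx.B μ μ = ctx.B ctx.θ ctx.θ}

/-- `Π_l`, the long simple roots -/
def SimpleLong : Set V := {μ | μ ∈ ctx.simple ∧ ctx.B μ μ = ctx.B ctx.θ ctx.θ}

/-- the dominance order `μ ≼ ν` on the root lattice: `ν - μ` is a nonnegative
integer combination of positive roots -/
def le (μ ν : V) : Prop := ν - μ ∈ AddSubmonoid.closure ctx.Pos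

/-- a (combinatorial) abelian ideal of `Δ⁺` -/
def IsAbelianIdeal (I : Set V) : Prop :=
  I ⊆ ctx.Pos ∧ (∀ μ ∈ I, ∀ ν ∈ I, μ + ν ∉ ctx.Δ) ∧
    ∀ γ ∈ I, ∀ ν ∈ ctx.Pos, γ + ν ∈ ctx.Δ → γ + ν ∈ I

/-- `γ` is a generator of the ideal `I` -/
def IsGenerator (I : Set V) (γ : V) : Prop := γ ∈ I ∧ ∀ α ∈ ctx.Pos, γ - α ∉ I

/-! ### The affine picture: `V̂ = V ⊕ ℚδ ⊕ ℚλ`, modelled as `V × ℚ × ℚ`,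
with `δ = (0,1,0)` and `λ = (0,0,1)`. -/

/-- the embedding of `V` into `V̂` -/
def emb (_ctx : RootSystemCtx V) (v : V) : V × ℚ × ℚ := (v, 0, 0)

/-- the imaginary root `δ` -/
def δhat (_ctx : RootSystemCtx V) : V × ℚ × ℚ := (0, 1, 0)

/-- the affine simple root `α₀ = δ - θ` -/
def alpha0 : V × ℚ × ℚ := (-ctx.θ, 1, 0)

/-- the extension of the inner product to `V̂`, with
`(δ,V)=(λ,V)=(δ,δ)=(λ,λ)=0` and `(δ,λ)=1` -/
noncomputable def Bhat : (V × ℚ × ℚ) →ₗ[ℚ] (V × ℚ × ℚ) →ₗ[ℚ] ℚ :=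
  LinearMap.mk₂ ℚ (fun x y => ctx.B x.1 y.1 + x.2.1 * y.2.2 + x.2.2 * y.2.1)
    (fun x x' y => by
      simp only [Prod.fst_add, Prod.snd_add, map_add, LinearMap.add_apply]; ring)
    (fun c x y => by
      simp only [Prod.smul_fst, Prod.smul_snd, map_smul, LinearMap.smul_apply,
        smul_eq_mul]; ring)
    (fun x y y' => by
      simp only [Prod.fst_add, Prod.snd_add, map_add]; ring)
    (fun c x y => by
      simp only [Prod.smul_fst, Prod.smul_snd, map_smul, smul_eq_mul]; ring)

/-- the set `Δ̂` of affine real roots -/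
def Δhat : Set (V × ℚ × ℚ) := {x | ∃ α ∈ ctx.Δ, ∃ k : ℤ, x = (α, (k : ℚ), 0)}

/-- the set `Δ̂⁺` of positive affine roots -/
def PosHat : Set (V × ℚ × ℚ) :=
  {x | ∃ α ∈ ctx.Pos, x = (α, 0, 0)} ∪
    {x | ∃ α ∈ ctx.Δ, ∃ k : ℤ, 1 ≤ k ∧ x = (α, (k : ℚ), 0)}

/-- the set `Π̂ = Π ∪ {α₀}` of affine simple roots -/
def SimpleHat : Set (V × ℚ × ℚ) :=
  {x | ∃ α ∈ ctx.simple, x = (α, (0 : ℚ), (0 : ℚ))} ∪ {ctx.alpha0}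

/-- the reflection `s_β : x ↦ x − (2(x,β)/(β,β))·β` in `V̂` -/
noncomputable def refl (β : V × ℚ × ℚ) : (V × ℚ × ℚ) ≃ₗ[ℚ] (V × ℚ × ℚ) :=
  if h : ctx.Bhat β β = 0 then LinearEquiv.refl ℚ _
  else
    Module.reflection (x := β) (f := (2 / ctx.Bhat β β) • ctx.Bhat β)
      (by simp only [LinearMap.smul_apply, smul_eq_mul]; field_simp)

/-- the affine Weyl group `Ŵ`, generated by the reflections `s_β`, `β ∈ Δ̂` -/
def What : Subgroup ((V × ℚ × ℚ) ≃ₗ[ℚ] (V × ℚ × ℚ)) :=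
  Subgroup.closure {g | ∃ β ∈ ctx.Δhat, g = ctx.refl β}

/-- the finite Weyl group `W`, generated by the reflections `s_α`, `α ∈ Δ`
(identified with a subgroup of `Ŵ`) -/
def Wfin : Subgroup ((V × ℚ × ℚ) ≃ₗ[ℚ] (V × ℚ × ℚ)) :=
  Subgroup.closure {g | ∃ α ∈ ctx.Δ, g = ctx.refl (α, (0 : ℚ), (0 : ℚ))}

/-- `N̂(w) = {β ∈ Δ̂⁺ : w(β) ∈ −Δ̂⁺}` -/
def Nhat (w : (V × ℚ × ℚ) ≃ₗ[ℚ] (V × ℚ × ℚ)) : Set (V × ℚ × ℚ) :=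
  {β | β ∈ ctx.PosHat ∧ -(w β) ∈ ctx.PosHat}

/-- a minuscule element of `Ŵ`: every element of `N̂(w)` has the form `δ - γ`
with `γ ∈ Δ⁺` -/
def IsMinuscule (w : (V × ℚ × ℚ) ≃ₗ[ℚ] (V × ℚ × ℚ)) : Prop :=
  w ∈ ctx.What ∧ ∀ β ∈ ctx.Nhat w, ∃ γ ∈ ctx.Pos, β = ctx.δhat - ctx.emb γ

/-- the abelian ideal `I_w` corresponding to a minuscule element `w` -/
def idealOf (w : (V × ℚ × ℚ) ≃ₗ[ℚ] (V × ℚ × ℚ)) : Set V :=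
  {γ | γ ∈ ctx.Pos ∧ ctx.δhat - ctx.emb γ ∈ ctx.Nhat w}

/-- the ideal `I` has rootlet `τ(I) = μ`, i.e. `I = I_w` for some minuscule `w`
with `w(α₀) + δ = μ` -/
def HasRootlet (I : Set V) (μ : V) : Prop :=
  ∃ w, ctx.IsMinuscule w ∧ ctx.idealOf w = I ∧ w ctx.alpha0 + ctx.δhat = ctx.emb μ

/-- `Ab_μ`, the set of nonempty abelian ideals with rootlet `μ` -/
def AbFiber (μ : V) : Set (Set V) := {I | I.Nonempty ∧ ctx.HasRootlet I μ}

/-- `N(u) = {γ ∈ Δ⁺ : u(γ) ∈ −Δ⁺}` for `u` in the finite Weyl group -/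
def Nfin (w : (V × ℚ × ℚ) ≃ₗ[ℚ] (V × ℚ × ℚ)) : Set V :=
  {γ | γ ∈ ctx.Pos ∧ -(w (ctx.emb γ)) ∈ ctx.PosHat}

/-- the length `l(u) = #N(u)` of an element of the finite Weyl group -/
noncomputable def lenFin (w : (V × ℚ × ℚ) ≃ₗ[ℚ] (V × ℚ × ℚ)) : ℕ :=
  (ctx.Nfin w).ncard

end RootSystemCtx

namespace RootSystemCtx

variable {V : Type*} [AddCommGroup V] [Module ℚ V] (ctx : RootSystemCtx V)

lemma ne_zero_of_mem {α : V} (hα : α ∈ ctx.Δ) : α ≠ 0 :=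
  fun h => ctx.zero_notMem_Δ (h ▸ hα)

lemma B_self_pos {α : V} (hα : α ∈ ctx.Δ) : 0 < ctx.B α α :=
  ctx.B_posdef α (ctx.ne_zero_of_mem hα)

/-- The sum of two roots at an obtuse angle is a root or zero. -/
lemma add_mem_of_neg {α β : V} (hα : α ∈ ctx.Δ) (hβ : β ∈ ctx.Δ) (h : ctx.B α β < 0) :
    α + β ∈ ctx.Δ ∨ α + β = 0 := by
  have pα := ctx.B_self_pos hα
  have pβ := ctx.B_self_pos hβ
  obtain ⟨m, hm⟩ := ctx.crystallographic α hα β hβ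
  obtain ⟨n, hn⟩ := ctx.crystallographic β hβ α hα
  have hsymm := ctx.B_symm β α
  have m_neg : m < 0 := by
    have : (m : ℚ) < 0 := hm ▸ div_neg_of_neg_of_pos (by linarith) pβ
    exact_mod_cast this
  have n_neg : n < 0 := by
    have : (n : ℚ) < 0 := hn ▸ div_neg_of_neg_of_pos (by linarith) pα
    exact_mod_cast this
  by_cases hm1 : m = -1
  · left
    have := ctx.reflect_mem β hβ α hα
    rw [hm, hm1] at this
    simpa using this
  by_cases hn1 : n = -1
  · left
    have := ctx.reflect_mem α hα β hβ
    rw [hn, hn1] at this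
    simpa [add_comm] using this
  right
  have hm2 : (m : ℚ) ≤ -2 := by exact_mod_cast (by omega : m ≤ -2)
  have hn2 : (n : ℚ) ≤ -2 := by exact_mod_cast (by omega : n ≤ -2)
  rw [div_eq_iff pβ.ne'] at hm
  rw [div_eq_iff pα.ne', hsymm] at hn
  have e1 : ctx.B α β ≤ -ctx.B β β := by nlinarith
  have e2 : ctx.B α β ≤ -ctx.B α α := by nlinarith
  by_contra hne
  have := ctx.B_posdef _ hne
  simp only [map_add, LinearMap.add_apply] at this
  linarith

/-- A nonempty sum of positive roots is nonzero. -/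
lemma multiset_sum_ne_zero (s : Multiset V) (hs : ∀ x ∈ s, x ∈ ctx.Pos) (h0 : s ≠ 0) :
    s.sum ≠ 0 := by
  induction hn : s.card using Nat.strong_induction_on generalizing s with
  | _ n ih =>
    intro hsum
    obtain ⟨a, ha⟩ := Multiset.exists_mem_of_ne_zero h0
    obtain ⟨t, rfl⟩ := Multiset.exists_cons_of_mem ha
    have haP : a ∈ ctx.Pos := hs a ha
    have haΔ := ctx.pos_subset haP
    have hneg : ∃ b ∈ t, ctx.B a b < 0 := by
      by_contra! hcon
      have h1 : 0 ≤ ctx.B a t.sum := by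
        rw [map_multiset_sum]
        refine Multiset.sum_nonneg fun x hx => ?_
        obtain ⟨b, hb, rfl⟩ := Multiset.mem_map.mp hx
        exact hcon b hb
      have h2 : ctx.B a (a ::ₘ t).sum = 0 := by rw [hsum, map_zero]
      rw [Multiset.sum_cons, map_add] at h2
      linarith [ctx.B_self_pos haΔ]
    obtain ⟨b, hb, hab⟩ := hneg
    obtain ⟨u, rfl⟩ := Multiset.exists_cons_of_mem hb
    have hbP : b ∈ ctx.Pos := hs b (by simp)
    rcases ctx.add_mem_of_neg haΔ (ctx.pos_subset hbP) hab with h | h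
    · have hP := ctx.add_pos_mem a haP b hbP h
      refine ih (((a + b) ::ₘ u).card) ?_ ((a + b) ::ₘ u) ?_ (Multiset.cons_ne_zero) rfl ?_
      · rw [← hn]; simp
      · intro x hx
        rcases Multiset.mem_cons.mp hx with rfl | hx
        · exact hP
        · exact hs x (by simp [hx])
      · simpa [add_assoc] using hsum
    · exact ctx.pos_not_neg a haP ((eq_neg_of_add_eq_zero_right h) ▸ hbP)

lemma neg_notMem_closure {α : V} (hα : α ∈ ctx.Pos) :
    -α ∉ AddSubmonoid.closure ctx.Pos := by
  intro h
  obtain ⟨s, hs, hsum⟩ := AddSubmonoid.exists_multiset_of_mem_closure h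
  refine ctx.multiset_sum_ne_zero (α ::ₘ s) ?_ Multiset.cons_ne_zero (by simp [hsum])
  intro x hx
  rcases Multiset.mem_cons.mp hx with rfl | hx
  · exact hα
  · exact hs x hx

lemma θ_add_notMem {α : V} (hα : α ∈ ctx.Pos) : ctx.θ + α ∉ ctx.Δ := fun h => by
  have := ctx.θ_highest _ h
  rw [sub_add_cancel_left] at this
  exact ctx.neg_notMem_closure hα this

/-- Every root other than `θ` can be raised by a positive root, within `Δ ∪ {0}`. -/
lemma exists_raise {μ : V} (hμ : μ ∈ ctx.Δ) (hne : μ ≠ ctx.θ) :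
    ∃ ν ∈ ctx.Pos, μ + ν ∈ ctx.Δ ∨ μ + ν = 0 := by
  by_contra! hcon
  have hdom : ∀ ν ∈ ctx.Pos, 0 ≤ ctx.B μ ν := by
    intro ν hν
    by_contra! h
    rcases ctx.add_mem_of_neg hμ (ctx.pos_subset hν) h with h | h
    · exact (hcon ν hν).1 h
    · exact (hcon ν hν).2 h
  have hcl : ∀ x ∈ AddSubmonoid.closure ctx.Pos, 0 ≤ ctx.B μ x := by
    intro x hx
    induction hx using AddSubmonoid.closure_induction with
    | mem x hx => exact hdom x hx
    | zero => simp
    | add x y _ _ hx hy => rw [map_add]; exact add_nonneg hx hy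
  have h1 := hcl _ (ctx.θ_highest μ hμ)
  have hθ := ctx.pos_subset ctx.θ_pos
  have h2 : ctx.B ctx.θ (-μ) < 0 := by
    rw [map_sub] at h1
    rw [map_neg, ctx.B_symm]
    linarith [ctx.B_self_pos hμ]
  rcases ctx.add_mem_of_neg hθ (ctx.neg_mem_Δ μ hμ) h2 with h | h
  · rcases ctx.mem_pos_or_neg_pos _ h with h' | h'
    · exact (hcon _ h').1 (by simpa using hθ)
    · apply ctx.neg_notMem_closure h'
      simpa [sub_eq_add_neg] using ctx.θ_highest μ hμ
  · exact hne (add_neg_eq_zero.mp h).symm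

lemma mem_posHat_iff {x : V × ℚ × ℚ} :
    x ∈ ctx.PosHat ↔
      ∃ α ∈ ctx.Δ, ∃ k : ℤ, x = (α, (k : ℚ), 0) ∧ 0 ≤ k ∧ (k = 0 → α ∈ ctx.Pos) := by
  constructor
  · rintro (⟨α, hα, rfl⟩ | ⟨α, hα, k, hk, rfl⟩)
    · exact ⟨α, ctx.pos_subset hα, 0, by simp, le_rfl, fun _ => hα⟩
    · exact ⟨α, hα, k, rfl, by omega, fun h => by omega⟩
  · rintro ⟨α, hα, k, rfl, hk, h⟩
    rcases hk.eq_or_lt with rfl | hk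
    · exact Or.inl ⟨α, h rfl, by simp⟩
    · exact Or.inr ⟨α, hα, k, hk, rfl⟩

lemma mk_mem_posHat_iff {α : V} {k : ℤ} :
    ((α, (k : ℚ), 0) : V × ℚ × ℚ) ∈ ctx.PosHat ↔
      α ∈ ctx.Δ ∧ 0 ≤ k ∧ (k = 0 → α ∈ ctx.Pos) := by
  rw [mem_posHat_iff]
  constructor
  · rintro ⟨β, hβ, l, h, h1, h2⟩
    obtain ⟨rfl, hkl⟩ : α = β ∧ (k : ℚ) = l := by simpa using h
    obtain rfl : k = l := by exact_mod_cast hkl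
    exact ⟨hβ, h1, h2⟩
  · rintro ⟨h, h1, h2⟩
    exact ⟨α, h, k, rfl, h1, h2⟩

lemma posHat_subset : ctx.PosHat ⊆ ctx.Δhat := by
  intro x hx
  obtain ⟨α, hα, k, rfl, -⟩ := ctx.mem_posHat_iff.mp hx
  exact ⟨α, hα, k, rfl⟩

lemma neg_mem_Δhat {x : V × ℚ × ℚ} (hx : x ∈ ctx.Δhat) : -x ∈ ctx.Δhat := by
  obtain ⟨α, hα, k, rfl⟩ := hx
  exact ⟨-α, ctx.neg_mem_Δ α hα, -k, by simp⟩

lemma posHat_or_neg {x : V × ℚ × ℚ} (hx : x ∈ ctx.Δhat) : x ∈ ctx.PosHat ∨ -x ∈ ctx.PosHat := by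
  obtain ⟨α, hα, k, rfl⟩ := hx
  have e : -((α, (k : ℚ), 0) : V × ℚ × ℚ) = (-α, ((-k : ℤ) : ℚ), 0) := by simp
  rw [e, mk_mem_posHat_iff, mk_mem_posHat_iff]
  have hn := ctx.neg_mem_Δ α hα
  rcases lt_trichotomy k 0 with h | rfl | h
  · exact Or.inr ⟨hn, by omega, fun h' => by omega⟩
  · rcases ctx.mem_pos_or_neg_pos α hα with h | h
    · exact Or.inl ⟨hα, le_rfl, fun _ => h⟩
    · exact Or.inr ⟨hn, by simp, fun _ => h⟩
  · exact Or.inl ⟨hα, by omega, fun h' => by omega⟩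

lemma neg_notMem_posHat {x : V × ℚ × ℚ} (hx : x ∈ ctx.PosHat) : -x ∉ ctx.PosHat := by
  obtain ⟨α, hα, k, rfl, hk, h⟩ := ctx.mem_posHat_iff.mp hx
  have e : -((α, (k : ℚ), 0) : V × ℚ × ℚ) = (-α, ((-k : ℤ) : ℚ), 0) := by simp
  rw [e, mk_mem_posHat_iff]
  rintro ⟨-, h1, h2⟩
  exact ctx.pos_not_neg α (h (by omega)) (h2 (by omega))

lemma add_mem_posHat {x y : V × ℚ × ℚ} (hx : x ∈ ctx.PosHat) (hy : y ∈ ctx.PosHat)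
    (hxy : x + y ∈ ctx.Δhat) : x + y ∈ ctx.PosHat := by
  obtain ⟨α, hα, k, rfl, hk, h⟩ := ctx.mem_posHat_iff.mp hx
  obtain ⟨β, hβ, l, rfl, hl, h'⟩ := ctx.mem_posHat_iff.mp hy
  obtain ⟨μ, hμ, m, e⟩ := hxy
  have hμ' : α + β = μ := congrArg Prod.fst e
  have e' : ((α, (k : ℚ), 0) + (β, (l : ℚ), 0) : V × ℚ × ℚ) = (α + β, ((k + l : ℤ) : ℚ), 0) := by
    simp
  rw [e', mk_mem_posHat_iff]
  exact ⟨hμ' ▸ hμ, by omega, fun h0 =>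
    ctx.add_pos_mem α (h (by omega)) β (h' (by omega)) (hμ' ▸ hμ)⟩

lemma Bhat_δhat {β : V × ℚ × ℚ} (hβ : β ∈ ctx.Δhat) : ctx.Bhat β ctx.δhat = 0 := by
  obtain ⟨α, hα, k, rfl⟩ := hβ
  simp [Bhat, δhat]

lemma refl_apply {β : V × ℚ × ℚ} (hβ : β ∈ ctx.Δhat) (x : V × ℚ × ℚ) :
    ctx.refl β x = x - (2 / ctx.Bhat β β * ctx.Bhat β x) • β := by
  have hne : ctx.Bhat β β ≠ 0 := by
    obtain ⟨α, hα, k, rfl⟩ := hβ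
    simpa [Bhat] using (ctx.B_self_pos hα).ne'
  rw [refl, dif_neg hne, Module.reflection_apply]
  simp

lemma refl_mul_self {β : V × ℚ × ℚ} : ctx.refl β * ctx.refl β = 1 := by
  unfold refl
  split_ifs
  · rfl
  · ext1 x
    exact Module.involutive_reflection _ x

lemma refl_mem_Δhat {β x : V × ℚ × ℚ} (hβ : β ∈ ctx.Δhat) (hx : x ∈ ctx.Δhat) :
    ctx.refl β x ∈ ctx.Δhat := by
  rw [ctx.refl_apply hβ]
  obtain ⟨α, hα, k, rfl⟩ := hβ
  obtain ⟨μ, hμ, l, rfl⟩ := hx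
  obtain ⟨n, hn⟩ := ctx.crystallographic μ hμ α hα
  have hc : 2 / ctx.B α α * ctx.B α μ = n := by rw [← hn, ctx.B_symm α μ]; ring
  have hr := ctx.reflect_mem α hα μ hμ
  rw [hn] at hr
  refine ⟨_, hr, l - n * k, ?_⟩
  simp [Bhat, hc]

lemma What_apply {w : (V × ℚ × ℚ) ≃ₗ[ℚ] (V × ℚ × ℚ)} (hw : w ∈ ctx.What) :
    (∀ x ∈ ctx.Δhat, w x ∈ ctx.Δhat) ∧ w ctx.δhat = ctx.δhat := by
  have inv_eq : ∀ β, (ctx.refl β)⁻¹ = ctx.refl β := fun β =>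
    inv_eq_of_mul_eq_one_left ctx.refl_mul_self
  have hrefl : ∀ β ∈ ctx.Δhat, (∀ x ∈ ctx.Δhat, ctx.refl β x ∈ ctx.Δhat) ∧
      ctx.refl β ctx.δhat = ctx.δhat := fun β hβ =>
    ⟨fun x hx => ctx.refl_mem_Δhat hβ hx, by
      rw [ctx.refl_apply hβ, ctx.Bhat_δhat hβ]; simp⟩
  induction hw using Subgroup.closure_induction'' with
  | mem g hg => obtain ⟨β, hβ, rfl⟩ := hg; exact hrefl β hβ
  | inv_mem g hg => obtain ⟨β, hβ, rfl⟩ := hg; rw [inv_eq]; exact hrefl β hβ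
  | one => exact ⟨fun x hx => hx, rfl⟩
  | mul g h _ _ hg hh =>
    exact ⟨fun x hx => hg.1 _ (hh.1 x hx), by rw [LinearEquiv.mul_apply, hh.2, hg.2]⟩

/-- Affine simple roots are indecomposable in `Δ̂⁺`. -/
lemma add_notMem_simpleHat {x y : V × ℚ × ℚ} (hx : x ∈ ctx.PosHat) (hy : y ∈ ctx.PosHat) :
    x + y ∉ ctx.SimpleHat := by
  obtain ⟨α, hα, k, rfl, hk, h⟩ := ctx.mem_posHat_iff.mp hx
  obtain ⟨β, hβ, l, rfl, hl, h'⟩ := ctx.mem_posHat_iff.mp hy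
  rintro (⟨μ, hμ, e⟩ | e)
  · obtain ⟨e1, e2⟩ : α + β = μ ∧ (k : ℚ) + l = 0 := by simpa using e
    have e3 : k + l = 0 := by exact_mod_cast e2
    exact hμ.2 ⟨α, h (by omega), β, h' (by omega), e1.symm⟩
  · obtain ⟨e1, e2⟩ : α + β = -ctx.θ ∧ (k : ℚ) + l = 1 := by
      simpa [alpha0] using e
    have e3 : k + l = 1 := by exact_mod_cast e2
    rcases (by omega : k = 0 ∨ l = 0) with h0 | h0
    · apply ctx.θ_add_notMem (h h0)
      have := ctx.neg_mem_Δ β hβ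
      rwa [show ctx.θ + α = -β by rw [← neg_neg ctx.θ, ← e1]; abel]
    · apply ctx.θ_add_notMem (h' h0)
      have := ctx.neg_mem_Δ α hα
      rwa [show ctx.θ + β = -α by rw [← neg_neg ctx.θ, ← e1]; abel]

/-- A positive affine root that is not simple decomposes into positive affine roots, where one
summand may be imaginary. -/
lemma exists_decomposition {x : V × ℚ × ℚ} (hx : x ∈ ctx.PosHat) (hs : x ∉ ctx.SimpleHat) :
    ∃ y ∈ ctx.PosHat, (∃ z ∈ ctx.PosHat, x = y + z) ∨
      ∃ m : ℤ, 1 ≤ m ∧ x = y + (m : ℚ) • ctx.δhat := by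
  obtain ⟨α, hα, k, rfl, hk, h⟩ := ctx.mem_posHat_iff.mp hx
  rcases hk.eq_or_lt with rfl | hk
  · have hαP := h rfl
    have hns : ∃ β ∈ ctx.Pos, ∃ γ ∈ ctx.Pos, α = β + γ := by
      by_contra hcon
      exact hs (Or.inl ⟨α, ⟨hαP, hcon⟩, by simp⟩)
    obtain ⟨β, hβ, γ, hγ, rfl⟩ := hns
    exact ⟨(β, 0, 0), Or.inl ⟨β, hβ, rfl⟩, Or.inl ⟨(γ, 0, 0), Or.inl ⟨γ, hγ, rfl⟩, by simp⟩⟩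
  · by_cases hθ : -α = ctx.θ
    · have hk1 : k ≠ 1 := by
        rintro rfl
        exact hs (Or.inr (by simp [alpha0, ← hθ]))
      refine ⟨(α, ((1 : ℤ) : ℚ), 0), ctx.mk_mem_posHat_iff.mpr ⟨hα, by simp, by simp⟩,
        Or.inr ⟨k - 1, by omega, ?_⟩⟩
      simp [δhat]
    · obtain ⟨ν, hν, h | h⟩ := ctx.exists_raise (ctx.neg_mem_Δ α hα) hθ
      · refine ⟨(ν, 0, 0), Or.inl ⟨ν, hν, rfl⟩, Or.inl ⟨(α - ν, (k : ℚ), 0), ?_, by simp⟩⟩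
        refine ctx.mk_mem_posHat_iff.mpr ⟨?_, by omega, fun h' => by omega⟩
        have := ctx.neg_mem_Δ _ h
        rwa [show α - ν = -(-α + ν) by abel]
      · obtain rfl : α = ν := (neg_add_eq_zero.mp h)
        exact ⟨(α, 0, 0), Or.inl ⟨α, hν, rfl⟩, Or.inr ⟨k, by omega, by simp [δhat]⟩⟩

lemma δhat_sub_emb (μ : V) : ctx.δhat - ctx.emb μ = (-μ, ((1 : ℤ) : ℚ), 0) := by
  simp [δhat, emb]

lemma δhat_sub_emb_mem_posHat {μ : V} (hμ : μ ∈ ctx.Δ) : ctx.δhat - ctx.emb μ ∈ ctx.PosHat := by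
  rw [δhat_sub_emb, mk_mem_posHat_iff]
  exact ⟨ctx.neg_mem_Δ μ hμ, by simp, by simp⟩

section Minuscule

variable {ctx} {w : (V × ℚ × ℚ) ≃ₗ[ℚ] (V × ℚ × ℚ)}

/-- A positive affine root not of the form `δ - μ`, `μ ∈ I_w`, is kept positive by a minuscule
`w`. -/
lemma IsMinuscule.apply_mem_posHat (hw : ctx.IsMinuscule w) {x : V × ℚ × ℚ} (hx : x ∈ ctx.PosHat)
    (h : ∀ μ ∈ ctx.idealOf w, x ≠ ctx.δhat - ctx.emb μ) : w x ∈ ctx.PosHat := by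
  refine (ctx.posHat_or_neg ((ctx.What_apply hw.1).1 x (ctx.posHat_subset hx))).resolve_right ?_
  intro hneg
  obtain ⟨μ, hμ, rfl⟩ := hw.2 x ⟨hx, hneg⟩
  exact h μ ⟨hμ, hx, hneg⟩ rfl

lemma IsMinuscule.apply_sub_mem_posHat (hw : ctx.IsMinuscule w) {μ : V} (hμ : μ ∈ ctx.Pos)
    (h : μ ∉ ctx.idealOf w) : w (ctx.δhat - ctx.emb μ) ∈ ctx.PosHat := by
  refine hw.apply_mem_posHat (ctx.δhat_sub_emb_mem_posHat (ctx.pos_subset hμ)) ?_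
  intro ν hν e
  obtain rfl : μ = ν := by simpa [emb] using e
  exact h hν

lemma IsMinuscule.apply_emb_mem_posHat (hw : ctx.IsMinuscule w) {μ : V} (hμ : μ ∈ ctx.Pos) :
    w (ctx.emb μ) ∈ ctx.PosHat := by
  refine hw.apply_mem_posHat (Or.inl ⟨μ, hμ, rfl⟩) ?_
  intro ν hν e
  simp [emb, δhat] at e

/-- If `μ + ν` is a root then `w` sends `(δ - μ) + (δ - ν)` to a positive affine root. -/
lemma IsMinuscule.apply_sub_add_sub_mem_posHat (hw : ctx.IsMinuscule w) {μ ν : V}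
    (h : μ + ν ∈ ctx.Δ) :
    w (ctx.δhat - ctx.emb μ) + w (ctx.δhat - ctx.emb ν) ∈ ctx.PosHat := by
  rw [← map_add]
  have e : ctx.δhat - ctx.emb μ + (ctx.δhat - ctx.emb ν) = (-(μ + ν), ((2 : ℤ) : ℚ), 0) := by
    simp only [δhat_sub_emb, Prod.mk_add_mk]
    refine Prod.ext (by simp only; abel) (Prod.ext (by norm_num) (by norm_num))
  refine hw.apply_mem_posHat ?_ ?_
  · rw [e, mk_mem_posHat_iff]
    exact ⟨ctx.neg_mem_Δ _ h, by simp, by simp⟩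
  · intro κ hκ e'
    rw [e, δhat_sub_emb] at e'
    simp at e'

/-- The abelian ideal attached to a minuscule element is indeed an abelian ideal. -/
lemma IsMinuscule.isAbelianIdeal_idealOf (hw : ctx.IsMinuscule w) :
    ctx.IsAbelianIdeal (ctx.idealOf w) := by
  refine ⟨fun μ hμ => hμ.1, fun μ hμ ν hν h => ?_, fun μ hμ ν hν h => ?_⟩
  · have h1 := hw.apply_sub_add_sub_mem_posHat h
    refine ctx.neg_notMem_posHat h1 ?_
    have h2 := ctx.neg_mem_Δhat (ctx.posHat_subset h1)
    rw [neg_add] at h2 ⊢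
    exact ctx.add_mem_posHat hμ.2.2 hν.2.2 h2
  · by_contra hcon
    have hP := ctx.add_pos_mem μ hμ.1 ν hν h
    have h1 := hw.apply_sub_mem_posHat hP hcon
    have h2 := hw.apply_emb_mem_posHat hν
    have e : w (ctx.δhat - ctx.emb (μ + ν)) + w (ctx.emb ν) = w (ctx.δhat - ctx.emb μ) := by
      rw [← map_add]
      simp [emb, δhat]
    refine ctx.neg_notMem_posHat (ctx.add_mem_posHat h1 h2 ?_) (e ▸ hμ.2.2)
    rw [e]
    exact (ctx.What_apply hw.1).1 _ (ctx.posHat_subset hμ.2.1)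

lemma IsMinuscule.isAbelianIdeal_insert (hw : ctx.IsMinuscule w) {γ : V} (hγ : γ ∈ ctx.Pos)
    (hs : w (ctx.δhat - ctx.emb γ) ∈ ctx.SimpleHat) :
    ctx.IsAbelianIdeal (insert γ (ctx.idealOf w)) := by
  obtain ⟨hI, hab, hid⟩ := hw.isAbelianIdeal_idealOf
  have key : ∀ ν ∈ ctx.idealOf w, γ + ν ∉ ctx.Δ := by
    intro ν hν h
    have h1 := hw.apply_sub_add_sub_mem_posHat h
    have := ctx.add_notMem_simpleHat h1 hν.2.2
    rw [add_neg_cancel_right] at this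
    exact this hs
  refine ⟨Set.insert_subset hγ hI, ?_, ?_⟩
  · rintro μ (rfl | hμ) ν (rfl | hν) h
    · have := ctx.reduced ν (ctx.pos_subset hγ) 2 (by rwa [two_smul])
      norm_num at this
    · exact key ν hν h
    · exact key μ hμ (by rwa [add_comm])
    · exact hab μ hμ ν hν h
  · rintro μ (rfl | hμ) ν hν h
    · right
      by_contra hcon
      have h1 := hw.apply_sub_mem_posHat (ctx.add_pos_mem μ hγ ν hν h) hcon
      have := ctx.add_notMem_simpleHat h1 (hw.apply_emb_mem_posHat hν)
      rw [← map_add] at this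
      apply this
      convert hs using 2
      simp [emb, δhat]
    · exact Or.inr (hid μ hμ ν hν h)

lemma IsMinuscule.apply_mem_simpleHat (hw : ctx.IsMinuscule w) {γ : V} (hγ : γ ∈ ctx.Pos)
    (hγI : γ ∉ ctx.idealOf w) (h : ctx.IsAbelianIdeal (insert γ (ctx.idealOf w))) :
    w (ctx.δhat - ctx.emb γ) ∈ ctx.SimpleHat := by
  by_contra hs
  have hwinv : w⁻¹ ∈ ctx.What := inv_mem hw.1
  have hfix : w ctx.δhat = ctx.δhat := (ctx.What_apply hw.1).2
  have pullback : ∀ y ∈ ctx.PosHat, ∃ a ∈ ctx.Δhat, w a = y := fun y hy =>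
    ⟨w⁻¹ y, (ctx.What_apply hwinv).1 y (ctx.posHat_subset hy), w.apply_symm_apply y⟩
  have neg_case : ∀ a, -a ∈ ctx.PosHat → w a ∈ ctx.PosHat →
      ∃ μ ∈ ctx.idealOf w, -a = ctx.δhat - ctx.emb μ := by
    intro a ha hwa
    by_contra! hcon
    have := hw.apply_mem_posHat ha hcon
    rw [map_neg] at this
    exact ctx.neg_notMem_posHat hwa this
  obtain ⟨y, hy, ⟨z, hz, e⟩ | ⟨m, hm, e⟩⟩ :=
    ctx.exists_decomposition (hw.apply_sub_mem_posHat hγ hγI) hs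
  · obtain ⟨a, ha, rfl⟩ := pullback y hy
    obtain ⟨b, hb, rfl⟩ := pullback z hz
    rw [← map_add] at e
    replace e := w.injective e
    have mixed : ∀ a b, b ∈ ctx.Δhat → w a ∈ ctx.PosHat → ctx.δhat - ctx.emb γ = a + b →
        -a ∉ ctx.PosHat := by
      intro a b hb hwa e hneg
      obtain ⟨μ, hμ, e'⟩ := neg_case a hneg hwa
      obtain ⟨β, hβ, l, rfl⟩ := hb
      refine h.2.1 γ (Set.mem_insert _ _) μ (Set.mem_insert_of_mem _ hμ) ?_
      have e1 : -γ = a.1 + β := by simpa [δhat, emb] using congrArg Prod.fst e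
      have e2 : -a.1 = -μ := by simpa [δhat, emb] using congrArg Prod.fst e'
      have := ctx.neg_mem_Δ β hβ
      rwa [show γ + μ = -β by rw [← neg_neg γ, e1, neg_inj.mp e2]; abel]
    have level_zero : ∀ (α β : V) (l : ℚ), α ∈ ctx.Pos → (β, l, 0) ∈ ctx.Δhat →
        w (β, l, 0) ∈ ctx.PosHat → ctx.δhat - ctx.emb γ ≠ (α, 0, 0) + (β, l, 0) := by
      intro α β l hα hb hwb e
      obtain ⟨e1, rfl⟩ : -γ = α + β ∧ 1 = l := by simpa [δhat, emb] using e
      have e2 : γ + α = -β := by rw [← neg_neg γ, e1]; abel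
      obtain ⟨β', hβ, l', e3⟩ := hb
      obtain rfl : β = β' := congrArg Prod.fst e3
      rcases h.2.2 γ (Set.mem_insert _ _) α hα (e2 ▸ ctx.neg_mem_Δ β hβ) with h' | h'
      · exact ctx.ne_zero_of_mem (ctx.pos_subset hα) (by simpa using h')
      · refine ctx.neg_notMem_posHat hwb ?_
        have := h'.2.2
        rwa [e2, δhat_sub_emb, neg_neg, Int.cast_one] at this
    have ha' := (ctx.posHat_or_neg ha).resolve_right (mixed a b hb hy e)
    have hb' := (ctx.posHat_or_neg hb).resolve_right (mixed b a ha hz (by rw [e, add_comm]))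
    obtain ⟨α, hα, k, rfl, hk, hk0⟩ := ctx.mem_posHat_iff.mp ha'
    obtain ⟨β, hβ, l, rfl, hl, hl0⟩ := ctx.mem_posHat_iff.mp hb'
    have e1 : (1 : ℚ) = k + l := by simpa [δhat, emb] using congrArg (fun x => x.2.1) e
    have e2 : 1 = k + l := by exact_mod_cast e1
    rcases (by omega : k = 0 ∨ l = 0) with rfl | rfl
    · exact level_zero α β l (hk0 rfl) hb hz (by simpa using e)
    · exact level_zero β α k (hl0 rfl) ha hy (by rw [e, add_comm]; simp)
  · obtain ⟨a, ha, rfl⟩ := pullback y hy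
    have e' : ctx.δhat - ctx.emb γ = a + (m : ℚ) • ctx.δhat := by
      apply w.injective
      rw [e, map_add, map_smul, hfix]
    have ea : -a = (γ, ((m - 1 : ℤ) : ℚ), 0) := by
      rw [← sub_eq_iff_eq_add.mpr e']
      simp [δhat, emb]
    obtain ⟨μ, hμ, e2⟩ := neg_case a
      (ea ▸ ctx.mk_mem_posHat_iff.mpr ⟨ctx.pos_subset hγ, by omega, fun _ => hγ⟩) hy
    rw [ea, δhat_sub_emb] at e2
    obtain rfl : γ = -μ := congrArg Prod.fst e2
    exact ctx.pos_not_neg μ hμ.1 hγ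

end Minuscule

end RootSystemCtx

/-- Theorem `extension`: for a minuscule `w` and `γ ∈ Δ⁺ \ I_w`,
the set `I_w ∪ {γ}` is an abelian ideal if and only if `w(δ − γ) ∈ Π̂`. -/
theorem statement_2 {V : Type*} [AddCommGroup V] [Module ℚ V] (ctx : RootSystemCtx V)
    (w : (V × ℚ × ℚ) ≃ₗ[ℚ] (V × ℚ × ℚ)) (hw : ctx.IsMinuscule w)
    (γ : V) (hγpos : γ ∈ ctx.Pos) (hγ : γ ∉ ctx.idealOf w) :
    ctx.IsAbelianIdeal (insert γ (ctx.idealOf w)) ↔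
      w (ctx.δhat - ctx.emb γ) ∈ ctx.SimpleHat := by
  exact ⟨hw.apply_mem_simpleHat hγpos hγ, hw.isAbelianIdeal_insert hγpos⟩
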